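/- The group G₁₆ = ⟨x, b ∣ x⁴ = b⁴ = 1, b x b⁻¹ = x⁻¹⟩ of order 16 satisfies α(G₁₆) = 18. -/

import Mathlib

/-- `graphAlpha G` is the minimum number of vertices of a finite simple graph whose
automorphism group is isomorphic to `G`. -/
noncomputable def graphAlpha (G : Type*) [Group G] : ℕ :=
  sInf {n : ℕ | ∃ Γ : SimpleGraph (Fin n), Nonempty ((Γ ≃g Γ) ≃* G)}

/-- The cyclic group of order `n`. -/
abbrev Cyc (n : ℕ) := Multiplicative (ZMod n)
/-- Relators of `G₁₆ = ⟨x, b ∣ x⁴ = b⁴ = 1, b x b⁻¹ = x⁻¹⟩`. -/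
def G16Rels : Set (FreeGroup (Fin 2)) :=
  {(FreeGroup.of 0) ^ 4, (FreeGroup.of 1) ^ 4,
    FreeGroup.of 1 * FreeGroup.of 0 * (FreeGroup.of 1)⁻¹ * FreeGroup.of 0}

/-- `G₁₆ = ⟨x, b ∣ x⁴ = b⁴ = 1, b x b⁻¹ = x⁻¹⟩ ≅ C₄ ⋊ C₄`. -/
abbrev G16 := PresentedGroup G16Rels

/-- The semidirect product `C₄ ⋊ C₄` with the second factor acting by inversion, in coordinates:
`⟨i, j⟩` stands for `x ^ i * b ^ j`. -/
@[ext]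
structure C4SemiC4 where
  /-- exponent of `x` -/
  rot : ZMod 4
  /-- exponent of `b` -/
  turn : ZMod 4
deriving DecidableEq, Fintype

namespace C4SemiC4

/-- Since `1 + 2 * j = (-1) ^ j` modulo `4`, this is the twisted multiplication. -/
instance : Mul C4SemiC4 := ⟨fun g h => ⟨g.rot + (1 + 2 * g.turn) * h.rot, g.turn + h.turn⟩⟩

instance : One C4SemiC4 := ⟨⟨0, 0⟩⟩

instance : Inv C4SemiC4 := ⟨fun g => ⟨-((1 + 2 * g.turn) * g.rot), -g.turn⟩⟩

theorem mul_def (g h : C4SemiC4) :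
    g * h = ⟨g.rot + (1 + 2 * g.turn) * h.rot, g.turn + h.turn⟩ := rfl

theorem one_def : (1 : C4SemiC4) = ⟨0, 0⟩ := rfl

instance : Group C4SemiC4 :=
  Group.ofLeftAxioms
    (fun g h k => by
      have four : (4 : ZMod 4) = 0 := rfl
      ext
      · simp only [mul_def]
        linear_combination (-(g.turn * h.turn * k.rot)) * four
      · simp only [mul_def]
        ring)
    (fun g => by ext <;> simp [mul_def, one_def])
    (by decide)

/-- The generator `x`. -/
abbrev x : C4SemiC4 := ⟨1, 0⟩

/-- The generator `b`. -/
abbrev b : C4SemiC4 := ⟨0, 1⟩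

/-- The central involution `x ^ 2`. -/
abbrev p : C4SemiC4 := ⟨2, 0⟩

/-- The central involution `b ^ 2`. -/
abbrev q : C4SemiC4 := ⟨0, 2⟩

theorem p_comm : ∀ g : C4SemiC4, p * g = g * p := by decide

theorem q_comm : ∀ g : C4SemiC4, q * g = g * q := by decide

theorem comm_of_mul_self_eq_one : ∀ g : C4SemiC4, g * g = 1 → ∀ h, g * h = h * g := by decide

section Action

variable {V : Type*} [MulAction C4SemiC4 V]

theorem p_smul_smul (g : C4SemiC4) (v : V) : p • g • v = g • p • v := by
  rw [smul_smul, smul_smul, p_comm]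

theorem q_smul_smul (g : C4SemiC4) (v : V) : q • g • v = g • q • v := by
  rw [smul_smul, smul_smul, q_comm]

theorem p_smul_smul_eq_iff (g : C4SemiC4) (v : V) : p • g • v = g • v ↔ p • v = v := by
  rw [p_smul_smul, smul_left_cancel_iff]

theorem q_smul_smul_eq_iff (g : C4SemiC4) (v : V) : q • g • v = g • v ↔ q • v = v := by
  rw [q_smul_smul, smul_left_cancel_iff]

theorem p_smul_p_smul (v : V) : p • p • v = v := by
  rw [smul_smul, show p * p = 1 from rfl, one_smul]

theorem q_smul_q_smul (v : V) : q • q • v = v := by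
  rw [smul_smul, show q * q = 1 from rfl, one_smul]

theorem mul_self_smul {g : C4SemiC4} {v : V} (h : g • v = v) : (g * g) • v = v := by
  rw [mul_smul, h, h]

theorem rot_smul_of_x_smul {v : V} (h : x • v = v ∨ x • v = q • v) (i : ZMod 4) :
    (⟨i, 0⟩ : C4SemiC4) • v = v ∨ (⟨i, 0⟩ : C4SemiC4) • v = q • v := by
  have hx : ∀ n : ℕ, x ^ n • v = v ∨ x ^ n • v = q • v := by
    intro n
    induction n with
    | zero => simp
    | succ n ih =>
      rw [pow_succ', mul_smul]
      rcases ih with ih | ih <;> rw [ih]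
      · exact h
      · rw [← q_smul_smul]
        rcases h with h | h <;> rw [h]
        · exact .inr rfl
        · exact .inl (q_smul_q_smul v)
  have hi : ∀ i : ZMod 4, (⟨i, 0⟩ : C4SemiC4) = x ^ i.val := by decide
  rw [hi]
  exact hx _

/-- A point moved by `x ^ 2` and fixed by `b ^ 2` either is fixed by some `x ^ i * b`, or has
stabilizer `{1, b ^ 2}`. -/
theorem stabilizer_of_p_smul_ne {y : V} (hp : p • y ≠ y) (hq : q • y = y)
    (hb : ∀ i : ZMod 4, (⟨i, 1⟩ : C4SemiC4) • y ≠ y) {g : C4SemiC4} (hg : g • y = y) :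
    g = 1 ∨ g = q := by
  have key : ∀ g : C4SemiC4, g = 1 ∨ g = q ∨ g = p ∨ g = p * q ∨ g * g = p ∨
      ∃ i, g = ⟨i, 1⟩ ∨ g = ⟨i, 1⟩ * q := by decide
  rcases key g with h | h | h | h | h | ⟨i, h | h⟩
  · exact .inl h
  · exact .inr h
  · exact absurd (h ▸ hg) hp
  · rw [h, mul_smul, hq] at hg
    exact absurd hg hp
  · exact absurd (h ▸ mul_self_smul hg) hp
  · exact absurd (h ▸ hg) (hb i)
  · rw [h, mul_smul, hq] at hg
    exact absurd hg (hb i)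

variable [DecidableEq V]

/-- The orbit of a point, as a finite set. -/
def orb (v : V) : Finset V := Finset.univ.image fun g : C4SemiC4 => g • v

theorem mem_orb {v w : V} : w ∈ orb v ↔ ∃ g : C4SemiC4, g • v = w := by
  simp [orb]

theorem orb_symm {v w : V} (h : w ∈ orb v) : v ∈ orb w := by
  obtain ⟨g, rfl⟩ := mem_orb.1 h
  exact mem_orb.2 ⟨g⁻¹, inv_smul_smul g v⟩

theorem orb_trans {u v w : V} (h : v ∈ orb u) (h' : w ∈ orb v) : w ∈ orb u := by
  obtain ⟨g, rfl⟩ := mem_orb.1 h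
  obtain ⟨k, rfl⟩ := mem_orb.1 h'
  exact mem_orb.2 ⟨k * g, mul_smul k g u⟩

theorem disjoint_orb {v w : V} (h : w ∉ orb v) : Disjoint (orb v) (orb w) :=
  Finset.disjoint_left.2 fun _ h₁ h₂ => h (orb_trans h₁ (orb_symm h₂))

theorem p_smul_eq_iff_of_mem_orb {v w : V} (h : w ∈ orb v) : p • w = w ↔ p • v = v := by
  obtain ⟨g, rfl⟩ := mem_orb.1 h
  exact p_smul_smul_eq_iff g v

theorem q_smul_eq_iff_of_mem_orb {v w : V} (h : w ∈ orb v) : q • w = w ↔ q • v = v := by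
  obtain ⟨g, rfl⟩ := mem_orb.1 h
  exact q_smul_smul_eq_iff g v

theorem card_le_card_orb (S : Finset C4SemiC4) (v : V)
    (h : ∀ s ∈ S, ∀ t ∈ S, (s⁻¹ * t) • v = v → s = t) : S.card ≤ (orb v).card := by
  refine Finset.card_le_card_of_injOn (fun g => g • v) (fun g _ => mem_orb.2 ⟨g, rfl⟩) ?_
  intro s hs t ht hst
  refine h s hs t ht ?_
  rw [mul_smul, inv_smul_eq_iff]
  exact hst.symm

theorem card_orb_of_free {v : V} (hp : p • v ≠ v) (hq : q • v ≠ v) (hr : (p * q) • v ≠ v) :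
    16 ≤ (orb v).card := by
  refine card_le_card_orb Finset.univ v fun s _ t _ h => ?_
  have key : ∀ g : C4SemiC4, g = 1 ∨ g = p ∨ g = q ∨ g = p * q ∨ g * g = p ∨ g * g = q := by
    decide
  have h2 := mul_self_smul h
  rcases key (s⁻¹ * t) with h' | h' | h' | h' | h' | h'
  · exact inv_mul_eq_one.1 h'
  all_goals simp_all

theorem card_orb_of_p_ne_of_q_ne {v : V} (hp : p • v ≠ v) (hq : q • v ≠ v) :
    8 ≤ (orb v).card := by
  refine card_le_card_orb {g | g.turn = 0 ∨ g.turn = 1} v fun s hs t ht h => ?_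
  have key : ∀ s t : C4SemiC4, (s.turn = 0 ∨ s.turn = 1) → (t.turn = 0 ∨ t.turn = 1) →
      s = t ∨ s⁻¹ * t = p ∨ (s⁻¹ * t) * (s⁻¹ * t) = p ∨ (s⁻¹ * t) * (s⁻¹ * t) = q := by decide
  have h2 := mul_self_smul h
  rcases key s t (by simpa using hs) (by simpa using ht) with h' | h' | h' | h'
  · exact h'
  · exact absurd (h' ▸ h) hp
  · exact absurd (h' ▸ h2) hp
  · exact absurd (h' ▸ h2) hq

theorem card_orb_of_q_ne {v : V} (hq : q • v ≠ v) : 4 ≤ (orb v).card := by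
  refine card_le_card_orb {g | g.rot = 0} v fun s hs t ht h => ?_
  have key : ∀ s t : C4SemiC4, s.rot = 0 → t.rot = 0 →
      s = t ∨ s⁻¹ * t = q ∨ (s⁻¹ * t) * (s⁻¹ * t) = q := by decide
  rcases key s t (by simpa using hs) (by simpa using ht) with h' | h' | h'
  · exact h'
  · exact absurd (h' ▸ h) hq
  · exact absurd (h' ▸ mul_self_smul h) hq

theorem card_orb_of_p_ne {v : V} (hp : p • v ≠ v) : 4 ≤ (orb v).card := by
  refine card_le_card_orb {g | g.turn = 0} v fun s hs t ht h => ?_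
  have key : ∀ s t : C4SemiC4, s.turn = 0 → t.turn = 0 →
      s = t ∨ s⁻¹ * t = p ∨ (s⁻¹ * t) * (s⁻¹ * t) = p := by decide
  rcases key s t (by simpa using hs) (by simpa using ht) with h' | h' | h'
  · exact h'
  · exact absurd (h' ▸ h) hp
  · exact absurd (h' ▸ mul_self_smul h) hp

theorem card_orb_of_x_ne {v : V} (hq : q • v ≠ v) (hx : x • v ≠ v) (hxq : x • v ≠ q • v) :
    8 ≤ (orb v).card := by
  refine card_le_card_orb {g | g.rot = 0 ∨ g.rot = 1} v fun s hs t ht h => ?_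
  have key : ∀ s t : C4SemiC4, (s.rot = 0 ∨ s.rot = 1) → (t.rot = 0 ∨ t.rot = 1) →
      s = t ∨ s⁻¹ * t = q ∨ (s⁻¹ * t) * (s⁻¹ * t) = q ∨ s⁻¹ * t = x ∨ s⁻¹ * t = x⁻¹ ∨
        s⁻¹ * t = q * x ∨ s⁻¹ * t = x⁻¹ * q := by decide
  rcases key s t (by simpa using hs) (by simpa using ht) with h' | h' | h' | h' | h' | h' | h'
  · exact h'
  · exact absurd (h' ▸ h) hq
  · exact absurd (h' ▸ mul_self_smul h) hq
  · exact absurd (h' ▸ h) hx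
  · rw [h', inv_smul_eq_iff] at h
    exact absurd h.symm hx
  · rw [h', mul_smul] at h
    exact absurd (by rw [← q_smul_q_smul (x • v), h]) hxq
  · rw [h', mul_smul, inv_smul_eq_iff] at h
    exact absurd h.symm hxq

theorem card_orb_of_stabilizer {y : V} (hy : ∀ g : C4SemiC4, g • y = y → g = 1 ∨ g = q) :
    8 ≤ (orb y).card := by
  refine card_le_card_orb {g | g.turn = 0 ∨ g.turn = 1} y fun s hs t ht h => ?_
  have key : ∀ s t : C4SemiC4, (s.turn = 0 ∨ s.turn = 1) → (t.turn = 0 ∨ t.turn = 1) →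
      s⁻¹ * t ≠ q := by decide
  rcases hy _ h with h' | h'
  · exact inv_mul_eq_one.1 h'
  · exact absurd h' (key s t (by simpa using hs) (by simpa using ht))

end Action

/-- `C4SemiC4` acts on the vertices of `Γ` as its full automorphism group. -/
structure IsFullAutAction {V : Type*} [MulAction C4SemiC4 V] (Γ : SimpleGraph V) : Prop where
  faithful : ∀ g : C4SemiC4, (∀ v : V, g • v = v) → g = 1
  adj_smul : ∀ (g : C4SemiC4) (u v : V), Γ.Adj (g • u) (g • v) ↔ Γ.Adj u v
  exists_smul : ∀ σ : Equiv.Perm V, (∀ u v, Γ.Adj (σ u) (σ v) ↔ Γ.Adj u v) →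
    ∃ g : C4SemiC4, ∀ v, σ v = g • v

namespace IsFullAutAction

variable {V : Type*} [MulAction C4SemiC4 V] {Γ : SimpleGraph V}

theorem adj_smul_left (H : IsFullAutAction Γ) {g : C4SemiC4} {v : V} (hv : g • v = v) (u : V) :
    Γ.Adj (g • u) v ↔ Γ.Adj u v := by
  conv_lhs => rw [← hv]
  exact H.adj_smul g u v

theorem adj_rot_smul_left (H : IsFullAutAction Γ) {u t : V} (hu : x • u = u ∨ x • u = q • u)
    (ht : q • t = t) (i : ZMod 4) : Γ.Adj ((⟨i, 0⟩ : C4SemiC4) • u) t ↔ Γ.Adj u t := by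
  rcases rot_smul_of_x_smul hu i with h | h <;> rw [h]
  exact H.adj_smul_left ht u

theorem adj_rot_smul_right (H : IsFullAutAction Γ) {u t : V} (hu : x • u = u ∨ x • u = q • u)
    (ht : q • t = t) (i : ZMod 4) : Γ.Adj ((⟨i, 0⟩ : C4SemiC4) • t) u ↔ Γ.Adj t u := by
  rw [Γ.adj_comm, Γ.adj_comm t u, ← H.adj_smul ⟨i, 0⟩ u t]
  exact (H.adj_rot_smul_left hu (by rwa [q_smul_smul_eq_iff]) i).symm

/-- An involution cannot be applied to part of an orbit only. -/
theorem not_partial_involution (H : IsFullAutAction Γ) {z : C4SemiC4} (hz : z * z = 1)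
    (T : Set V) (hT : ∀ u ∈ T, z • u ∈ T)
    (hcross : ∀ u ∈ T, ∀ w ∉ T, (Γ.Adj (z • u) w ↔ Γ.Adj u w))
    {u : V} (hu : u ∈ T) (hzu : z • u ≠ u) (h : C4SemiC4) : h • u ∈ T := by
  classical
  by_contra hh
  have zz : ∀ v : V, z • z • v = v := fun v => by rw [smul_smul, hz, one_smul]
  let f : V → V := fun v => if v ∈ T then z • v else v
  have hf : Function.Involutive f := fun v => by
    by_cases hv : v ∈ T
    · simp [f, hv, hT v hv, zz]
    · simp [f, hv]
  obtain ⟨g, hg⟩ := H.exists_smul hf.toPerm fun a c => by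
    simp only [Function.Involutive.coe_toPerm, f]
    split_ifs with ha hc hc
    · exact H.adj_smul z a c
    · exact hcross a ha c hc
    · rw [Γ.adj_comm, Γ.adj_comm a]
      exact hcross c hc a ha
    · rfl
  have hgg : g * g = 1 := H.faithful _ fun v => by
    rw [mul_smul, ← hg, ← hg]
    exact hf v
  have h1 : g • h • u = h • u := by
    rw [← hg]
    simp [f, hh]
  have h2 : g • u = z • u := by
    rw [← hg]
    simp [f, hu]
  rw [smul_smul, comm_of_mul_self_eq_one g hgg, mul_smul, smul_left_cancel_iff, h2] at h1
  exact hzu h1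

variable [DecidableEq V]

/-- An orbit on which `b ^ 2` acts nontrivially interacts with another such orbit. -/
theorem exists_not_adj_q_smul_iff (H : IsFullAutAction Γ) {v : V} (hv : q • v ≠ v) :
    ∃ w ∉ orb v, ∃ u ∈ orb v, ¬(Γ.Adj (q • u) w ↔ Γ.Adj u w) := by
  by_contra! hcon
  let T : Set V := {t | ∃ g : C4SemiC4, 2 * g.turn ≠ 0 ∧ g • v = t}
  have hvT : v ∉ T := by
    rintro ⟨g, hg, hgv⟩
    have key : ∀ g : C4SemiC4, 2 * g.turn ≠ 0 → g * g = q := by decide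
    exact hv (key g hg ▸ mul_self_smul hgv)
  have hbT : b • v ∈ T := ⟨b, by decide, rfl⟩
  refine hvT ?_
  rw [← inv_smul_smul b v]
  refine H.not_partial_involution (z := q) rfl T ?_ ?_ hbT
    (by rwa [Ne, q_smul_smul_eq_iff]) b⁻¹
  · rintro _ ⟨g, hg, rfl⟩
    have key : ∀ g : C4SemiC4, 2 * g.turn ≠ 0 → 2 * (q * g).turn ≠ 0 := by decide
    exact ⟨q * g, key g hg, mul_smul q g v⟩
  · rintro _ ⟨g, hg, rfl⟩ w hw
    by_cases hwv : w ∈ orb v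
    · obtain ⟨a, rfl⟩ := mem_orb.1 hwv
      have ha : 2 * a.turn = 0 := by
        by_contra ha
        exact hw ⟨a, ha, rfl⟩
      have key : ∀ g a : C4SemiC4, 2 * g.turn ≠ 0 → 2 * a.turn = 0 → a * g⁻¹ * a = q * g := by
        decide
      rw [← H.adj_smul (a * g⁻¹) (g • v) (a • v), smul_smul (a * g⁻¹) g, smul_smul (a * g⁻¹) a,
        inv_mul_cancel_right, key g a hg ha, Γ.adj_comm, mul_smul]
    · exact hcon w hwv (g • v) (mem_orb.2 ⟨g, rfl⟩)

/-- An orbit with point stabilizer `⟨x ^ i * b⟩` is not the only one moved by `x ^ 2`. -/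
theorem exists_p_smul_ne (H : IsFullAutAction Γ) {y : V} (hy : p • y ≠ y) {i : ZMod 4}
    (hi : (⟨i, 1⟩ : C4SemiC4) • y = y) : ∃ w ∉ orb y, p • w ≠ w := by
  by_contra! hcon
  let g : C4SemiC4 := ⟨i, 1⟩
  let T : Set V := {t | t = x • y ∨ t = x • p • y}
  have hxT : x • y ∈ T := .inl rfl
  have hyT : y ∉ T := by
    rintro (h | h)
    · exact hy (mul_self_smul h.symm)
    · rw [smul_smul] at h
      exact hy (mul_self_smul h.symm)
  refine hyT ?_
  rw [← inv_smul_smul x y]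
  refine H.not_partial_involution (z := p) rfl T ?_ ?_ hxT
    (by rwa [Ne, p_smul_smul_eq_iff]) x⁻¹
  · rintro _ (rfl | rfl)
    · exact .inr (p_smul_smul x y)
    · exact .inl (by rw [p_smul_smul, p_smul_p_smul])
  · intro u hu w hw
    by_cases hwy : w ∈ orb y
    · have hgw : g • w = w := by
        obtain ⟨h, rfl⟩ := mem_orb.1 hwy
        have key : ∀ (i : ZMod 4) (h : C4SemiC4),
            (h = ⟨i, 1⟩ ^ h.turn.val ∨ h = p * ⟨i, 1⟩ ^ h.turn.val) ∨
            (h = x * ⟨i, 1⟩ ^ h.turn.val ∨ h = x * p * ⟨i, 1⟩ ^ h.turn.val) := by decide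
        have hpow : ∀ n : ℕ, g ^ n • y = y := fun n => by
          induction n with
          | zero => simp
          | succ n ih => rw [pow_succ, mul_smul, hi, ih]
        rcases key i h with (h' | h') | (h' | h')
        · rw [h', hpow, hi]
        · rw [h', mul_smul, hpow, ← p_smul_smul, hi]
        · refine absurd (.inl ?_) hw
          rw [h', mul_smul, hpow]
        · refine absurd (.inr ?_) hw
          rw [h', mul_smul, hpow, mul_smul]
      have hgu : g • u = p • u := by
        have key : ∀ i : ZMod 4, (⟨i, 1⟩ : C4SemiC4) * x = p * x * ⟨i, 1⟩ := by decide
        have hgx : g • x • y = p • x • y := by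
          rw [smul_smul, key i, mul_smul, hi, mul_smul]
        rcases hu with rfl | rfl
        · exact hgx
        · rw [← p_smul_smul, ← p_smul_smul, hgx]
      rw [← hgu]
      exact H.adj_smul_left hgw u
    · exact H.adj_smul_left (hcon w hwy) u

variable [Fintype V]

theorem not_free (H : IsFullAutAction Γ) (hV : Fintype.card V ≤ 17) {v : V} (hp : p • v ≠ v)
    (hq : q • v ≠ v) : (p * q) • v = v := by
  by_contra hr
  obtain ⟨w, hw, u, -, huw⟩ := H.exists_not_adj_q_smul_iff hq
  have hqw : q • w ≠ w := fun h => huw (H.adj_smul_left h u)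
  have h1 := card_orb_of_free hp hq hr
  have h2 := card_orb_of_q_ne hqw
  have h3 := Finset.card_union_of_disjoint (disjoint_orb hw)
  have h4 := Finset.card_le_univ (orb v ∪ orb w)
  omega

theorem p_smul_eq_or_q_smul_eq (H : IsFullAutAction Γ) (hV : Fintype.card V ≤ 17) (v : V) :
    p • v = v ∨ q • v = v := by
  by_contra! ⟨hp, hq⟩
  have hr := H.not_free hV hp hq
  obtain ⟨w, hw, u, hu, huw⟩ := H.exists_not_adj_q_smul_iff hq
  have hru : p • u = q • u := by
    obtain ⟨g, rfl⟩ := mem_orb.1 hu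
    rw [p_smul_smul, q_smul_smul, smul_left_cancel_iff]
    rw [mul_smul] at hr
    rw [← hr, p_smul_p_smul, hr]
  have hqw : q • w ≠ w := fun h => huw (H.adj_smul_left h u)
  have hpw : p • w ≠ w := fun h => huw (hru ▸ H.adj_smul_left h u)
  have hrw := H.not_free hV hpw hqw
  obtain ⟨y, hy⟩ : ∃ y : V, (p * q) • y ≠ y := by
    by_contra! h
    exact absurd (H.faithful _ h) (by decide)
  have hcomm : ∀ g : C4SemiC4, (p * q) * g = g * (p * q) := by decide
  have hne : ∀ t : V, (p * q) • t = t → ∀ g : C4SemiC4, (p * q) • g • t = g • t := fun t ht g => by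
    rw [smul_smul, hcomm, mul_smul, ht]
  have hyv : y ∉ orb v ∪ orb w := by
    intro h
    rcases Finset.mem_union.1 h with h | h <;> obtain ⟨g, rfl⟩ := mem_orb.1 h
    · exact hy (hne v hr g)
    · exact hy (hne w hrw g)
  have hryv : (p * q) • y ∉ orb v ∪ orb w := by
    intro h
    have : (p * q) • (p * q) • y = y := by
      rw [smul_smul, show p * q * (p * q) = 1 from rfl, one_smul]
    refine hyv ?_
    rcases Finset.mem_union.1 h with h | h
    · exact Finset.mem_union_left _ (orb_trans h (mem_orb.2 ⟨p * q, this⟩))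
    · exact Finset.mem_union_right _ (orb_trans h (mem_orb.2 ⟨p * q, this⟩))
  have h1 := card_orb_of_p_ne_of_q_ne hp hq
  have h2 := card_orb_of_p_ne_of_q_ne hpw hqw
  have h3 := Finset.card_union_of_disjoint (disjoint_orb hw)
  have h4 := Finset.card_le_univ (insert y (insert ((p * q) • y) (orb v ∪ orb w)))
  rw [Finset.card_insert_of_notMem, Finset.card_insert_of_notMem hryv] at h4
  · omega
  · rw [Finset.mem_insert, not_or]
    exact ⟨hy.symm, hyv⟩

theorem exists_two_q_orbits (H : IsFullAutAction Γ) :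
    ∃ v w : V, w ∉ orb v ∧ q • v ≠ v ∧ q • w ≠ w := by
  obtain ⟨v, hv⟩ : ∃ v : V, q • v ≠ v := by
    by_contra! h
    exact absurd (H.faithful _ h) (by decide)
  obtain ⟨w, hw, u, -, huw⟩ := H.exists_not_adj_q_smul_iff hv
  exact ⟨v, w, hw, hv, fun h => huw (H.adj_smul_left h u)⟩

theorem orb_subset_q_moved {v : V} (hv : q • v ≠ v) :
    orb v ⊆ Finset.univ.filter fun t : V => q • t ≠ t := fun t ht => by
  simpa [q_smul_eq_iff_of_mem_orb ht] using hv

theorem orb_subset_p_moved {v : V} (hv : p • v ≠ v) :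
    orb v ⊆ Finset.univ.filter fun t : V => p • t ≠ t := fun t ht => by
  simpa [p_smul_eq_iff_of_mem_orb ht] using hv

theorem card_q_moved (H : IsFullAutAction Γ) :
    8 ≤ (Finset.univ.filter fun t : V => q • t ≠ t).card := by
  obtain ⟨v, w, hw, hqv, hqw⟩ := H.exists_two_q_orbits
  have h1 := card_orb_of_q_ne hqv
  have h2 := card_orb_of_q_ne hqw
  have h3 := Finset.card_union_of_disjoint (disjoint_orb hw)
  have h4 := Finset.card_le_card
    (Finset.union_subset (orb_subset_q_moved hqv) (orb_subset_q_moved hqw))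
  omega

theorem card_p_moved (H : IsFullAutAction Γ) (hV : Fintype.card V ≤ 17) :
    8 ≤ (Finset.univ.filter fun t : V => p • t ≠ t).card := by
  obtain ⟨y, hy⟩ : ∃ y : V, p • y ≠ y := by
    by_contra! h
    exact absurd (H.faithful _ h) (by decide)
  have hqy : q • y = y := (H.p_smul_eq_or_q_smul_eq hV y).resolve_left hy
  by_cases hb : ∃ i : ZMod 4, (⟨i, 1⟩ : C4SemiC4) • y = y
  · obtain ⟨i, hi⟩ := hb
    obtain ⟨w, hw, hpw⟩ := H.exists_p_smul_ne hy hi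
    have h1 := card_orb_of_p_ne hy
    have h2 := card_orb_of_p_ne hpw
    have h3 := Finset.card_union_of_disjoint (disjoint_orb hw)
    have h4 := Finset.card_le_card
      (Finset.union_subset (orb_subset_p_moved hy) (orb_subset_p_moved hpw))
    omega
  · push Not at hb
    exact (card_orb_of_stabilizer fun g hg => stabilizer_of_p_smul_ne hy hqy hb hg).trans
      (Finset.card_le_card (orb_subset_p_moved hy))

theorem card_moved (H : IsFullAutAction Γ) (hV : Fintype.card V ≤ 17) :
    (Finset.univ.filter fun t : V => q • t ≠ t).card +
      (Finset.univ.filter fun t : V => p • t ≠ t).card ≤ 17 := by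
  rw [← Finset.card_union_of_disjoint]
  · exact (Finset.card_le_univ _).trans hV
  · refine Finset.disjoint_left.2 fun t h1 h2 => ?_
    rw [Finset.mem_filter] at h1 h2
    exact (H.p_smul_eq_or_q_smul_eq hV t).elim h2.2 h1.2

theorem x_smul_of_q_smul_ne (H : IsFullAutAction Γ) (hV : Fintype.card V ≤ 17) {t : V}
    (ht : q • t ≠ t) : x • t = t ∨ x • t = q • t := by
  by_contra! ⟨hx, hxq⟩
  obtain ⟨w, hw, hqw⟩ : ∃ w ∉ orb t, q • w ≠ w := by
    obtain ⟨v, w, hw, hqv, hqw⟩ := H.exists_two_q_orbits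
    by_cases h : w ∈ orb t
    · exact ⟨v, fun hv => hw (orb_trans (orb_symm hv) h), hqv⟩
    · exact ⟨w, h, hqw⟩
  have h1 := card_orb_of_x_ne ht hx hxq
  have h2 := card_orb_of_q_ne hqw
  have h3 := Finset.card_union_of_disjoint (disjoint_orb hw)
  have h4 := Finset.card_le_card
    (Finset.union_subset (orb_subset_q_moved ht) (orb_subset_q_moved hqw))
  have h5 := H.card_p_moved hV
  have h6 := H.card_moved hV
  omega

theorem smul_eq_of_p_smul_of_q_smul (H : IsFullAutAction Γ) (hV : Fintype.card V ≤ 17) {t : V}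
    (hp : p • t = t) (hq : q • t = t) (g : C4SemiC4) : g • t = t := by
  by_contra hg
  have hdisj : Disjoint (Finset.univ.filter fun t : V => q • t ≠ t)
      (Finset.univ.filter fun t : V => p • t ≠ t) :=
    Finset.disjoint_left.2 fun t h1 h2 => by
      rw [Finset.mem_filter] at h1 h2
      exact (H.p_smul_eq_or_q_smul_eq hV t).elim h2.2 h1.2
  have h1 := Finset.card_union_of_disjoint hdisj
  have h2 := H.card_q_moved
  have h3 := H.card_p_moved hV
  have h4 := Finset.card_le_univ (insert t (insert (g • t)
    ((Finset.univ.filter fun t : V => q • t ≠ t) ∪ Finset.univ.filter fun t : V => p • t ≠ t)))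
  rw [Finset.card_insert_of_notMem, Finset.card_insert_of_notMem] at h4
  · omega
  · simp [p_smul_smul_eq_iff, q_smul_smul_eq_iff, hp, hq]
  · simpa [hp, hq] using Ne.symm hg

theorem x_smul_of_p_smul (H : IsFullAutAction Γ) (hV : Fintype.card V ≤ 17) {t : V}
    (hp : p • t = t) : x • t = t ∨ x • t = q • t := by
  by_cases hq : q • t = t
  · exact .inl (H.smul_eq_of_p_smul_of_q_smul hV hp hq x)
  · exact H.x_smul_of_q_smul_ne hV hq

/-- Otherwise `b` could be applied to the vertices moved by `b ^ 2` only. -/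
theorem exists_rot_stabilizer (H : IsFullAutAction Γ) (hV : Fintype.card V ≤ 17) :
    ∃ y : V, p • y ≠ y ∧ ∀ i : ZMod 4, (⟨i, 1⟩ : C4SemiC4) • y ≠ y := by
  by_contra! hcon
  have hcross : ∀ u t : V, q • u ≠ u → q • t = t → (Γ.Adj (b • u) t ↔ Γ.Adj u t) := by
    intro u t hu ht
    by_cases hp : p • t = t
    · exact H.adj_smul_left (H.smul_eq_of_p_smul_of_q_smul hV hp ht b) u
    · obtain ⟨i, hi⟩ := hcon t hp
      have hqb : q • b • u ≠ b • u := by rwa [Ne, q_smul_smul_eq_iff]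
      rw [← H.adj_rot_smul_left (H.x_smul_of_q_smul_ne hV hqb) ht i, smul_smul,
        show ∀ i : ZMod 4, (⟨i, 0⟩ : C4SemiC4) * b = ⟨i, 1⟩ by decide]
      exact H.adj_smul_left hi u
  let σ : Equiv.Perm V :=
    { toFun := fun v => if q • v = v then v else b • v
      invFun := fun v => if q • v = v then v else b⁻¹ • v
      left_inv := fun v => by
        by_cases h : q • v = v
        · simp [h]
        · simp [h, q_smul_smul_eq_iff]
      right_inv := fun v => by
        by_cases h : q • v = v
        · simp [h]
        · simp [h, q_smul_smul_eq_iff] }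
  obtain ⟨g, hg⟩ := H.exists_smul σ fun u t => by
    simp only [σ, Equiv.coe_fn_mk]
    split_ifs with hu ht ht
    · rfl
    · rw [Γ.adj_comm, Γ.adj_comm u]
      exact hcross t u ht hu
    · exact hcross u t hu ht
    · exact H.adj_smul b u t
  obtain ⟨v, -, -, hv, -⟩ := H.exists_two_q_orbits
  obtain ⟨y, hy⟩ : ∃ y : V, p • y ≠ y := by
    by_contra! h
    exact absurd (H.faithful _ h) (by decide)
  have hqy : q • y = y := (H.p_smul_eq_or_q_smul_eq hV y).resolve_left hy
  have hgy : ∀ t : V, q • t = t → g • t = t := fun t ht => by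
    rw [← hg]
    simp [σ, ht]
  have hgv : ∀ t : V, q • t ≠ t → g • t = b • t := fun t ht => by
    rw [← hg]
    simp [σ, ht]
  have key : ∀ g : C4SemiC4, g * g = 1 ∨ g * g = p ∨ x⁻¹ * g⁻¹ * x * g = p := by decide
  rcases key g with h | h | h
  · have hv2 : (g * g) • v = q • v := by
      rw [mul_smul, hgv v hv, hgv _ (by rwa [Ne, q_smul_smul_eq_iff]), smul_smul]
      rfl
    rw [h, one_smul] at hv2
    exact hv hv2.symm
  · exact hy (h ▸ mul_self_smul (hgy y hqy))
  · refine hy ?_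
    have hxy : g • x • y = x • y := hgy _ (by rwa [q_smul_smul_eq_iff])
    rw [← h, mul_smul, hgy y hqy, mul_smul, mul_smul, inv_smul_eq_iff, inv_smul_eq_iff, hxy]

theorem seventeen_lt_card (H : IsFullAutAction Γ) : 17 < Fintype.card V := by
  by_contra! hV
  obtain ⟨y, hp, hb⟩ := H.exists_rot_stabilizer hV
  have hq : q • y = y := (H.p_smul_eq_or_q_smul_eq hV y).resolve_left hp
  have hstab : ∀ g : C4SemiC4, g • y = y → g = 1 ∨ g = q := fun g hg =>
    stabilizer_of_p_smul_ne hp hq hb hg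
  have hout : ∀ w ∉ orb y, p • w = w := by
    intro w hw
    by_contra hpw
    have h1 := card_orb_of_stabilizer hstab
    have h2 := card_orb_of_p_ne hpw
    have h3 := Finset.card_union_of_disjoint (disjoint_orb hw)
    have h4 := Finset.card_le_card
      (Finset.union_subset (orb_subset_p_moved hp) (orb_subset_p_moved hpw))
    have h5 := H.card_q_moved
    have h6 := H.card_moved hV
    omega
  let lab : ZMod 4 × Bool → C4SemiC4 := fun a => ⟨a.1, if a.2 then 1 else 0⟩
  let f : ZMod 4 × Bool ↪ V := ⟨fun a => lab a • y, fun a c hac => by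
    have key : ∀ a c : ZMod 4 × Bool, a ≠ c →
        (lab a)⁻¹ * lab c ≠ 1 ∧ (lab a)⁻¹ * lab c ≠ q := by decide
    by_contra hne
    have h : ((lab a)⁻¹ * lab c) • y = y := by
      rw [mul_smul, inv_smul_eq_iff]
      exact hac.symm
    exact (hstab _ h).elim (key a c hne).1 (key a c hne).2⟩
  have hf : ∀ a, f a = lab a • y := fun _ => rfl
  have hqf : ∀ a, q • f a = f a := fun a => (q_smul_smul_eq_iff _ _).2 hq
  have hrange : ∀ w, w ∉ Set.range f → w ∉ orb y := by
    rintro w hw hwy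
    obtain ⟨g, rfl⟩ := mem_orb.1 hwy
    have key : ∀ g : C4SemiC4, ∃ a, g = lab a ∨ g = lab a * q := by decide
    obtain ⟨a, h | h⟩ := key g
    · exact hw ⟨a, by rw [hf, h]⟩
    · exact hw ⟨a, by rw [hf, h, mul_smul, hq]⟩
  have hrot : ∀ (k : ZMod 4) (a : ZMod 4 × Bool),
      (⟨k, 0⟩ : C4SemiC4) • f a = f (k + a.1, a.2) := fun k a => by
    rw [hf, smul_smul, hf]
    congr 1
    simp [lab, mul_def]
  have hadj : ∀ (k : ZMod 4) (a c : ZMod 4 × Bool),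
      Γ.Adj (f (k + a.1, a.2)) (f (k + c.1, c.2)) ↔ Γ.Adj (f a) (f c) := fun k a c => by
    rw [← hrot, ← hrot]
    exact H.adj_smul _ _ _
  -- Every subset of a square is preserved by some reflection of the square.
  obtain ⟨m, hm⟩ : ∃ m : ZMod 4, ∀ j, Γ.Adj (f (0, false)) (f (m - j, true)) ↔
      Γ.Adj (f (0, false)) (f (j, true)) := by
    classical
    have key : ∀ J : ZMod 4 → Bool, ∃ m, ∀ j, J (m - j) = J j := by decide
    obtain ⟨m, hm⟩ := key fun j => decide (Γ.Adj (f (0, false)) (f (j, true)))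
    exact ⟨m, fun j => by simpa using hm j⟩
  have hmix : ∀ i k : ZMod 4, Γ.Adj (f (-i, false)) (f (m - k, true)) ↔
      Γ.Adj (f (i, false)) (f (k, true)) := fun i k => by
    have h1 := hadj i (-i, false) (m - k, true)
    have h2 := hadj (-i) (i, false) (k, true)
    have h3 := hm (-i + k)
    simp only [add_neg_cancel, neg_add_cancel] at h1 h2
    rw [← h1, ← h2, ← h3, show i + (m - k) = m - (-i + k) by ring]
  let π : Equiv.Perm (ZMod 4 × Bool) := Function.Involutive.toPerm
    (fun a => (if a.2 then m - a.1 else -a.1, a.2)) fun a => by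
      rcases a with ⟨i, _ | _⟩ <;> simp
  have hπ : ∀ a : ZMod 4 × Bool, π a = (if a.2 then m - a.1 else -a.1, a.2) := fun _ => rfl
  have hcross : ∀ (a : ZMod 4 × Bool) (w : V), w ∉ Set.range f →
      (Γ.Adj (f (π a)) w ↔ Γ.Adj (f a) w) := by
    intro a w hw
    have h := H.adj_rot_smul_right (H.x_smul_of_p_smul hV (hout w (hrange w hw))) (hqf a)
      ((π a).1 - a.1)
    rwa [hrot, sub_add_cancel] at h
  obtain ⟨g, hg⟩ := H.exists_smul (π.viaEmbedding f) fun u w => by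
    by_cases hu : u ∈ Set.range f <;> by_cases hw : w ∈ Set.range f
    · obtain ⟨a, rfl⟩ := hu
      obtain ⟨c, rfl⟩ := hw
      rw [Equiv.Perm.viaEmbedding_apply, Equiv.Perm.viaEmbedding_apply, hπ, hπ]
      rcases a with ⟨i, _ | _⟩ <;> rcases c with ⟨k, _ | _⟩
      · rw [← hadj (i + k), Γ.adj_comm]
        simp
      · simpa using hmix i k
      · rw [Γ.adj_comm, Γ.adj_comm (f (i, true))]
        simpa using hmix k i
      · rw [← hadj (i + k - m), Γ.adj_comm]
        simp
    · obtain ⟨a, rfl⟩ := hu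
      rw [Equiv.Perm.viaEmbedding_apply, Equiv.Perm.viaEmbedding_apply_of_notMem _ _ _ hw]
      exact hcross a w hw
    · obtain ⟨c, rfl⟩ := hw
      rw [Equiv.Perm.viaEmbedding_apply, Equiv.Perm.viaEmbedding_apply_of_notMem _ _ _ hu,
        Γ.adj_comm, Γ.adj_comm u]
      exact hcross c u hu
    · rw [Equiv.Perm.viaEmbedding_apply_of_notMem _ _ _ hu,
        Equiv.Perm.viaEmbedding_apply_of_notMem _ _ _ hw]
  have hg0 : g • f (0, false) = f (0, false) := by
    rw [← hg, Equiv.Perm.viaEmbedding_apply, hπ]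
    simp
  have hg1 : g • f (1, false) = f (-1, false) := by
    rw [← hg, Equiv.Perm.viaEmbedding_apply, hπ]
    simp
  have hy0 : f (0, false) = y := one_smul _ y
  have hfix : g • f (1, false) = f (1, false) := by
    rcases hstab g (hy0 ▸ hg0) with rfl | rfl
    · exact one_smul _ _
    · exact hqf _
  rw [hfix] at hg1
  exact absurd (f.injective hg1) (by decide)

end IsFullAutAction
end C4SemiC4

namespace G16

/-- The generator `x` of `G₁₆`. -/
def x : G16 := PresentedGroup.of 0

/-- The generator `b` of `G₁₆`. -/
def b : G16 := PresentedGroup.of 1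

theorem x_pow_four : x ^ 4 = 1 :=
  PresentedGroup.one_of_mem (rels := G16Rels) (x := FreeGroup.of 0 ^ 4) (by simp [G16Rels])

theorem b_pow_four : b ^ 4 = 1 :=
  PresentedGroup.one_of_mem (rels := G16Rels) (x := FreeGroup.of 1 ^ 4) (by simp [G16Rels])

theorem b_mul_x : b * x = x ^ 3 * b := by
  have h : b * x * b⁻¹ * x = 1 :=
    PresentedGroup.one_of_mem (rels := G16Rels)
      (x := FreeGroup.of 1 * FreeGroup.of 0 * (FreeGroup.of 1)⁻¹ * FreeGroup.of 0)
      (by simp [G16Rels])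
  have hx : x⁻¹ = x ^ 3 := inv_eq_of_mul_eq_one_left (by rw [← pow_succ, x_pow_four])
  rw [← hx, ← mul_eq_one_iff_eq_inv.1 h, inv_mul_cancel_right]

theorem b_mul_x_pow (n : ℕ) : b * x ^ n = x ^ (3 * n) * b := by
  induction n with
  | zero => simp
  | succ n ih => rw [pow_succ, ← mul_assoc, ih, mul_assoc, b_mul_x, ← mul_assoc, ← pow_add]; rfl

theorem exists_eq_pow_mul_pow (g : G16) : ∃ i j : ℕ, g = x ^ i * b ^ j := by
  have hx : x⁻¹ = x ^ 3 := inv_eq_of_mul_eq_one_left (by rw [← pow_succ, x_pow_four])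
  have hb : b⁻¹ = b ^ 3 := inv_eq_of_mul_eq_one_left (by rw [← pow_succ, b_pow_four])
  have hxmul : ∀ (n i j : ℕ), ∃ k l : ℕ, x ^ n * (x ^ i * b ^ j) = x ^ k * b ^ l := fun n i j =>
    ⟨n + i, j, by rw [← mul_assoc, ← pow_add]⟩
  have hbmul : ∀ (n i j : ℕ), ∃ k l : ℕ, b ^ n * (x ^ i * b ^ j) = x ^ k * b ^ l := by
    intro n
    induction n with
    | zero => exact fun i j => ⟨i, j, by simp⟩
    | succ n ih =>
      intro i j
      obtain ⟨k, l, h⟩ := ih (3 * i) (j + 1)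
      exact ⟨k, l, by rw [← h, pow_succ, mul_assoc, ← mul_assoc b, b_mul_x_pow, mul_assoc,
        ← pow_succ']⟩
  have hg : g ∈ Subgroup.closure (Set.range (PresentedGroup.of : Fin 2 → G16)) := by
    rw [PresentedGroup.closure_range_of]
    trivial
  induction hg using Subgroup.closure_induction_left with
  | one => exact ⟨0, 0, by simp⟩
  | mul_left s hs t _ ih =>
    obtain ⟨i, j, rfl⟩ := ih
    obtain ⟨c, rfl⟩ := hs
    fin_cases c
    · have h := hxmul 1 i j
      rw [pow_one] at h
      exact h
    · have h := hbmul 1 i j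
      rw [pow_one] at h
      exact h
  | inv_mul_cancel s hs t _ ih =>
    obtain ⟨i, j, rfl⟩ := ih
    obtain ⟨c, rfl⟩ := hs
    fin_cases c
    · obtain ⟨k, l, h⟩ := hxmul 3 i j
      exact ⟨k, l, by rw [← h, ← hx]; rfl⟩
    · obtain ⟨k, l, h⟩ := hbmul 3 i j
      exact ⟨k, l, by rw [← h, ← hb]; rfl⟩

theorem exists_eq_pow_mul_pow_lt (g : G16) : ∃ i j : Fin 4, g = x ^ (i : ℕ) * b ^ (j : ℕ) := by
  obtain ⟨i, j, rfl⟩ := exists_eq_pow_mul_pow g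
  refine ⟨⟨i % 4, Nat.mod_lt _ (by norm_num)⟩, ⟨j % 4, Nat.mod_lt _ (by norm_num)⟩, ?_⟩
  rw [pow_eq_pow_mod i x_pow_four, pow_eq_pow_mod j b_pow_four]

section Lift

variable {H : Type*} [Group H] {X B : H}

/-- The homomorphism from `G₁₆` given by images of the generators that satisfy the relations. -/
def lift (hX : X ^ 4 = 1) (hB : B ^ 4 = 1) (hXB : B * X * B⁻¹ * X = 1) : G16 →* H :=
  PresentedGroup.toGroup (f := ![X, B]) (by
    rintro r (rfl | rfl | rfl) <;> simpa)

variable (hX : X ^ 4 = 1) (hB : B ^ 4 = 1) (hXB : B * X * B⁻¹ * X = 1)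

theorem lift_pow_mul_pow (i j : ℕ) : lift hX hB hXB (x ^ i * b ^ j) = X ^ i * B ^ j := by
  rw [map_mul, map_pow, map_pow]
  congr 2 <;> exact PresentedGroup.toGroup.of _

theorem lift_bijective (hinj : ∀ i j : Fin 4, X ^ (i : ℕ) * B ^ (j : ℕ) = 1 → i = 0 ∧ j = 0)
    (hsurj : ∀ h : H, ∃ i j : ℕ, h = X ^ i * B ^ j) : Function.Bijective (lift hX hB hXB) := by
  refine ⟨(injective_iff_map_eq_one _).2 fun g hg => ?_, fun h => ?_⟩
  · obtain ⟨i, j, rfl⟩ := exists_eq_pow_mul_pow_lt g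
    rw [lift_pow_mul_pow] at hg
    obtain ⟨rfl, rfl⟩ := hinj i j hg
    simp
  · obtain ⟨i, j, rfl⟩ := hsurj h
    exact ⟨_, lift_pow_mul_pow hX hB hXB i j⟩

end Lift

/-- The coordinates on `G₁₆`. -/
noncomputable def equivC4SemiC4 : G16 ≃* C4SemiC4 :=
  MulEquiv.ofBijective (lift (X := C4SemiC4.x) (B := C4SemiC4.b) (by decide) (by decide)
    (by decide)) (lift_bijective _ _ _ (by decide) (by
      have key : ∀ h : C4SemiC4, h = C4SemiC4.x ^ h.rot.val * C4SemiC4.b ^ h.turn.val := by decide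
      exact fun h => ⟨_, _, key h⟩))

theorem seventeen_lt_of_autEquiv {V : Type*} [Fintype V] (Γ : SimpleGraph V)
    (e : (Γ ≃g Γ) ≃* G16) : 17 < Fintype.card V := by
  classical
  let φ : C4SemiC4 ≃* (Γ ≃g Γ) := (e.trans equivC4SemiC4).symm
  let _ : MulAction C4SemiC4 V :=
    { smul := fun g v => φ g v
      one_smul := fun v => by
        change φ 1 v = v
        rw [map_one]
        rfl
      mul_smul := fun g h v => by
        change φ (g * h) v = φ g (φ h v)
        rw [map_mul]
        rfl }
  have hφ : ∀ (g : C4SemiC4) (v : V), g • v = φ g v := fun _ _ => rfl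
  refine C4SemiC4.IsFullAutAction.seventeen_lt_card (Γ := Γ) ⟨fun g hg => ?_, fun g u v => ?_,
    fun σ hσ => ?_⟩
  · refine φ.injective ?_
    rw [map_one]
    exact RelIso.ext hg
  · exact (φ g).map_rel_iff
  · refine ⟨φ.symm ⟨σ, hσ _ _⟩, fun v => ?_⟩
    rw [hφ, MulEquiv.apply_symm_apply]
    rfl

/-- Adjacency lists, written in binary, of a graph on `u₀, …, u₃, v₀, …, v₃, d₀, …, d₃, e₀, …, e₃,
c₀, c₁` (in this order) with these edges, indices being read modulo `4`, and modulo `2` for `c`: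
`uᵢ` to `vᵢ` and `vᵢ₊₁`; `vᵢ` to `vᵢ₊₁`; `uᵢ` and `vᵢ` to all `dₖ` if `i` is even and to all `eₖ` if
`i` is odd; `dᵢ` to `eᵢ` and `eᵢ₊₁`; `dᵢ` and `eᵢ` to `cᵢ`. -/
def rows : Fin 18 → ℕ :=
  ![3888, 61536, 4032, 61584, 4009, 61523, 4006, 61532, 77909, 155733, 114773, 168021, 68010,
    132010, 67242, 134314, 21760, 43520]

/-- A graph on `18` vertices with automorphism group `G₁₆`. -/
def graph : SimpleGraph (Fin 18) where
  Adj u v := (rows u).testBit v = true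
  symm := ⟨by decide⟩
  loopless := ⟨by decide⟩

instance : DecidableRel graph.Adj := fun _ _ => inferInstanceAs (Decidable (_ = true))

/-- The automorphism of `graph` that raises the indices of `d`, `e` and `c`. -/
def autX : graph ≃g graph where
  toFun := ![0, 1, 2, 3, 4, 5, 6, 7, 9, 10, 11, 8, 13, 14, 15, 12, 17, 16]
  invFun := ![0, 1, 2, 3, 4, 5, 6, 7, 11, 8, 9, 10, 15, 12, 13, 14, 17, 16]
  left_inv := by decide
  right_inv := by decide
  map_rel_iff' := by decide

/-- The automorphism of `graph` that raises the indices of `u` and `v`, and exchanges `dₖ` and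
`e₋ₖ`. -/
def autB : graph ≃g graph where
  toFun := ![1, 2, 3, 0, 5, 6, 7, 4, 12, 15, 14, 13, 8, 11, 10, 9, 16, 17]
  invFun := ![3, 0, 1, 2, 7, 4, 5, 6, 12, 15, 14, 13, 8, 11, 10, 9, 16, 17]
  left_inv := by decide
  right_inv := by decide
  map_rel_iff' := by decide

theorem eq_one_of_fixed (σ : graph ≃g graph) (h0 : σ 0 = 0) (h8 : σ 8 = 8) : σ = 1 := by
  have step : ∀ known : List (Fin 18), (∀ t ∈ known, σ t = t) → ∀ new : List (Fin 18),
      (∀ w ∈ new, ∀ y, graph.degree y = graph.degree w →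
        (∀ t ∈ known, (y = t ↔ w = t) ∧ (graph.Adj y t ↔ graph.Adj w t)) →
          y = w) → ∀ w ∈ new, σ w = w := by
    intro known hk new hn w hw
    refine hn w hw (σ w) (σ.degree_eq w) fun t ht => ⟨?_, ?_⟩
    all_goals conv_lhs => rw [← hk t ht]
    · exact σ.injective.eq_iff
    · exact σ.map_adj_iff
  have h1 := step [0, 8] (by simp [h0, h8]) [0, 8, 4, 5, 6, 7, 16, 17] (by decide)
  have h2 := step _ h1 [0, 8, 4, 5, 6, 7, 16, 17, 1, 2, 3, 12, 13, 14, 15] (by decide)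
  have h3 := step _ h2 (List.finRange 18) (by decide)
  exact RelIso.ext fun w => h3 w (List.mem_finRange w)

theorem exists_eq_autX_pow_mul_autB_pow (σ : graph ≃g graph) :
    ∃ i j : ℕ, σ = autX ^ i * autB ^ j := by
  have key : ∀ a c : Fin 18, graph.degree a = graph.degree 0 → graph.degree c = graph.degree 8 →
      graph.Adj a c → ∃ i j : Fin 4, (autX ^ (i : ℕ) * autB ^ (j : ℕ)) 0 = a ∧
        (autX ^ (i : ℕ) * autB ^ (j : ℕ)) 8 = c := by decide
  obtain ⟨i, j, h0, h8⟩ := key (σ 0) (σ 8) (σ.degree_eq 0) (σ.degree_eq 8)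
    (σ.map_adj_iff.2 (by decide))
  refine ⟨i, j, (inv_mul_eq_one.1 (eq_one_of_fixed _ ?_ ?_)).symm⟩
  · rw [RelIso.mul_apply, ← h0]
    exact RelIso.inv_apply_self _ _
  · rw [RelIso.mul_apply, ← h8]
    exact RelIso.inv_apply_self _ _

theorem nonempty_autEquiv : Nonempty ((graph ≃g graph) ≃* G16) := by
  have ext_of : ∀ σ τ : graph ≃g graph, (∀ v, σ v = τ v) → σ = τ := fun _ _ h => RelIso.ext h
  refine ⟨(MulEquiv.ofBijective (lift (X := autX) (B := autB) (ext_of _ _ (by decide))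
    (ext_of _ _ (by decide)) (ext_of _ _ (by decide)))
    (lift_bijective _ _ _ (fun i j h => ?_) exists_eq_autX_pow_mul_autB_pow)).symm⟩
  have key : ∀ i j : Fin 4, (autX ^ (i : ℕ) * autB ^ (j : ℕ)) 0 = 0 →
      (autX ^ (i : ℕ) * autB ^ (j : ℕ)) 8 = 8 → i = 0 ∧ j = 0 := by decide
  exact key i j (by rw [h]; rfl) (by rw [h]; rfl)

end G16

/-- Proposition: the group `G₁₆ = ⟨x, b ∣ x⁴ = b⁴ = 1, b x b⁻¹ = x⁻¹⟩` of
order 16 satisfies `α(G₁₆) = 18`. -/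
theorem alpha_G16 : graphAlpha G16 = 18 := by
  have hmem : 18 ∈ {n : ℕ | ∃ Γ : SimpleGraph (Fin n), Nonempty ((Γ ≃g Γ) ≃* G16)} :=
    ⟨G16.graph, G16.nonempty_autEquiv⟩
  refine le_antisymm (Nat.sInf_le hmem) (le_csInf ⟨18, hmem⟩ ?_)
  rintro n ⟨Γ, ⟨e⟩⟩
  simpa [Nat.succ_le_iff] using G16.seventeen_lt_of_autEquiv Γ e
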